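/- arXiv:math/0602610 — 2 statements merged into one kernel-verified Lean document; each statement's English description precedes it below -/
import Mathlib

section
/- Fix κ ∈ ℕ, n ≥ 1 and 0 ≤ k ≤ n−1. For each N with N ≥ max(n+1, κ+1), let V^{N,κ} be the truncated solution with top row (N,κ). Then V^{N,κ} n k converges, as N → ∞, to C(n+κ−k, n)/(κ+1)^n, where C denotes the binomial coefficient. -/
/-- Number of descents of a permutation of `Fin n`: indices `j` with `j+1 < n`
and `π j > π (j+1)`. -/
noncomputable def descents {n : ℕ} (π : Equiv.Perm (Fin n)) : ℕ :=
  Nat.card {j : Fin n // ∃ h : (j : ℕ) + 1 < n, π ⟨(j : ℕ) + 1, h⟩ < π j}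

/-- The Eulerian number `⟨n,k⟩`: the number of permutations of `Fin n` with
exactly `k` descents. -/
noncomputable def eulerian (n k : ℕ) : ℕ :=
  Nat.card {π : Equiv.Perm (Fin n) // descents π = k}

/-- `IsTrunc N κ V` : `V` is the truncated solution with top row `(N, κ)`:
the top row `V N ·` is the delta at `κ` normalized by the Eulerian number
`⟨N,κ⟩`, and the dual recursion holds for `1 ≤ n ≤ N-1`, `0 ≤ k ≤ n-1`. -/
def IsTrunc (N κ : ℕ) (V : ℕ → ℕ → ℝ) : Prop :=
  (∀ k : ℕ, k ≤ N - 1 → V N k = if k = κ then 1 / (eulerian N κ : ℝ) else 0) ∧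
  (∀ n k : ℕ, 1 ≤ n → n ≤ N - 1 → k ≤ n - 1 →
    V n k = ((k : ℝ) + 1) * V (n + 1) k + ((n : ℝ) - (k : ℝ)) * V (n + 1) (k + 1))

open Classical in
/-- Number of descents at positions below `p`. -/
noncomputable def desBelow {N : ℕ} (π : Equiv.Perm (Fin N)) (p : ℕ) : ℕ :=
  ((Finset.range p).filter
    (fun q => ∃ h : q + 1 < N, π ⟨q + 1, h⟩ < π ⟨q, by omega⟩)).card

lemma desBelow_zero {N : ℕ} (π : Equiv.Perm (Fin N)) : desBelow π 0 = 0 := by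
  simp [desBelow]

lemma desBelow_succ_pos {N : ℕ} (π : Equiv.Perm (Fin N)) (p : ℕ)
    (h : ∃ h : p + 1 < N, π ⟨p + 1, h⟩ < π ⟨p, by omega⟩) :
    desBelow π (p + 1) = desBelow π p + 1 := by
  unfold desBelow
  rw [Finset.range_add_one, Finset.filter_insert, if_pos h, Finset.card_insert_of_notMem]
  simp

lemma desBelow_succ_neg {N : ℕ} (π : Equiv.Perm (Fin N)) (p : ℕ)
    (h : ¬ ∃ h : p + 1 < N, π ⟨p + 1, h⟩ < π ⟨p, by omega⟩) :
    desBelow π (p + 1) = desBelow π p := by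
  unfold desBelow
  rw [Finset.range_add_one, Finset.filter_insert, if_neg h]

lemma desBelow_mono {N : ℕ} (π : Equiv.Perm (Fin N)) : Monotone (desBelow π) := by
  intro a b hab
  unfold desBelow
  apply Finset.card_le_card
  apply Finset.filter_subset_filter
  simpa using hab

lemma descents_eq {N : ℕ} (π : Equiv.Perm (Fin N)) : descents π = desBelow π N := by
  classical
  unfold descents desBelow
  rw [Nat.card_eq_fintype_card, Fintype.card_subtype]
  refine Finset.card_bij (fun j _ => (j : ℕ)) ?_ ?_ ?_
  · intro j hj
    simp only [Finset.mem_filter, Finset.mem_univ, true_and] at hj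
    simp only [Finset.mem_filter, Finset.mem_range]
    exact ⟨j.2, hj⟩
  · intro a _ b _ h
    exact Fin.ext h
  · intro b hb
    simp only [Finset.mem_filter, Finset.mem_range] at hb
    refine ⟨⟨b, hb.1⟩, ?_, rfl⟩
    simp only [Finset.mem_filter, Finset.mem_univ, true_and]
    exact hb.2

lemma lt_of_desBelow_eq {N : ℕ} (π : Equiv.Perm (Fin N)) (i : ℕ) (hi : i < N) (d : ℕ)
    (hj : i + d + 1 < N) (h : desBelow π i = desBelow π (i + d + 1)) :
    π ⟨i, hi⟩ < π ⟨i + d + 1, hj⟩ := by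
  induction d with
  | zero =>
    by_contra hc
    have hne : π ⟨i, hi⟩ ≠ π ⟨i + 0 + 1, hj⟩ := by
      intro he
      have := congrArg Fin.val (π.injective he)
      simp at this
    have := desBelow_succ_pos π i ⟨hj, lt_of_le_of_ne (not_lt.mp hc) hne.symm⟩
    simp only [add_zero] at h
    omega
  | succ d ih =>
    have h1 := desBelow_mono π (show i ≤ i + d + 1 by omega)
    have h2 := desBelow_mono π (show i + d + 1 ≤ i + (d + 1) + 1 by omega)
    refine lt_trans (ih (by omega) (by omega)) ?_
    by_contra hc
    have hne : π ⟨i + d + 1, by omega⟩ ≠ π ⟨i + (d + 1) + 1, hj⟩ := by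
      intro he
      have := congrArg Fin.val (π.injective he)
      simp at this
    have := desBelow_succ_pos π (i + d + 1) ⟨hj, lt_of_le_of_ne (not_lt.mp hc) hne.symm⟩
    have e : i + (d + 1) + 1 = i + d + 1 + 1 := by omega
    rw [e] at h
    omega

lemma eulerian_le (N κ : ℕ) : eulerian N κ ≤ (κ + 1) ^ N := by
  classical
  have hle : ∀ (π : {π : Equiv.Perm (Fin N) // descents π = κ}) (v : Fin N),
      desBelow π.1 (π.1.symm v) < κ + 1 := by
    intro π v
    have := π.2
    rw [descents_eq] at this
    have h2 := desBelow_mono π.1 (π.1.symm v).2.le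
    omega
  let w : {π : Equiv.Perm (Fin N) // descents π = κ} → (Fin N → Fin (κ + 1)) :=
    fun π v => ⟨desBelow π.1 (π.1.symm v), hle π v⟩
  have key : ∀ π, π.1 = Tuple.sort (w π) := by
    intro π
    rw [Tuple.eq_sort_iff]
    constructor
    · intro i j hij
      simp only [w, Function.comp, Equiv.symm_apply_apply, Fin.mk_le_mk]
      exact desBelow_mono π.1 hij
    · intro i j hij h
      simp only [w, Equiv.symm_apply_apply, Fin.mk.injEq] at h
      have hij' : i.1 < j.1 := hij
      obtain ⟨d, hd⟩ := Nat.exists_eq_add_of_lt hij'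
      obtain ⟨j, hj⟩ := j
      simp only at hd
      subst hd
      exact lt_of_desBelow_eq π.1 i.1 i.2 d hj h
  have hinj : Function.Injective w := by
    intro a b hab
    apply Subtype.ext
    rw [key a, key b, hab]
  unfold eulerian
  rw [Nat.card_eq_fintype_card]
  have := Fintype.card_le_of_injective w hinj
  simpa using this

/-- Words in which every boundary between consecutive letters forces a descent. -/
def GoodWord {N κ : ℕ} (f : Fin N → Fin (κ + 1)) : Prop :=
  ∀ c : ℕ, c < κ → ∃ i j : Fin N, (f i : ℕ) = c ∧ (f j : ℕ) = c + 1 ∧ j < i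

lemma good_val {N κ : ℕ} (f : Fin N → Fin (κ + 1)) (hf : GoodWord f) (p : ℕ) (hp : p < N) :
    (f (Tuple.sort f ⟨p, hp⟩) : ℕ) = desBelow (Tuple.sort f) p := by
  obtain ⟨hm, hs⟩ := (Tuple.eq_sort_iff (f := f) (σ := Tuple.sort f)).mp rfl
  set σ := Tuple.sort f with hσ
  have hm' : ∀ i j : Fin N, i ≤ j → (f (σ i) : ℕ) ≤ f (σ j) := fun i j h => hm h
  have hs' : ∀ i j : Fin N, i ≤ j → (f (σ i) : ℕ) = f (σ j) → σ i ≤ σ j := by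
    intro i j h e
    rcases h.eq_or_lt with h | h
    · rw [h]
    · exact (hs i j h (Fin.ext e)).le
  induction p with
  | zero =>
    rw [desBelow_zero]
    rcases Nat.eq_zero_or_pos κ with h0 | h0
    · have := (f (σ ⟨0, hp⟩)).2
      omega
    · obtain ⟨i, j, hi, -, -⟩ := hf 0 h0
      have := hm' ⟨0, hp⟩ (σ.symm i) (Fin.mk_le_of_le_val (Nat.zero_le _))
      simp only [Equiv.apply_symm_apply] at this
      omega
  | succ p ih =>
    have ih := ih (by omega)
    have hmp := hm' ⟨p, by omega⟩ ⟨p + 1, hp⟩ (by simp)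
    rcases hmp.eq_or_lt with h | h
    · rw [desBelow_succ_neg, ← ih, h]
      rintro ⟨_, h2⟩
      exact absurd h2 (not_lt.mpr (hs' _ _ (by simp) h))
    · have hlt := (f (σ ⟨p + 1, hp⟩)).2
      obtain ⟨i, j, hi, hj, hji⟩ := hf (f (σ ⟨p, by omega⟩)) (by omega)
      obtain ⟨q, rfl⟩ := σ.surjective j
      obtain ⟨r, rfl⟩ := σ.surjective i
      have hq : (⟨p + 1, hp⟩ : Fin N) ≤ q := by
        by_contra hc
        have : q ≤ (⟨p, by omega⟩ : Fin N) := by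
          have : q.1 < p + 1 := not_le.mp hc
          exact Fin.mk_le_mk.mpr (by omega)
        have := hm' _ _ this
        omega
      have hr : r ≤ (⟨p, by omega⟩ : Fin N) := by
        by_contra hc
        have : (⟨p + 1, hp⟩ : Fin N) ≤ r := by
          have : p < r.1 := not_le.mp hc
          exact Fin.mk_le_mk.mpr (by omega)
        have := hm' _ _ this
        omega
      have hq1 := hm' _ _ hq
      have e : (f (σ ⟨p + 1, hp⟩) : ℕ) = f (σ ⟨p, by omega⟩) + 1 := by omega
      rw [desBelow_succ_pos, ← ih, e]
      refine ⟨hp, ?_⟩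
      exact lt_of_le_of_lt (hs' _ _ hq (by omega)) (lt_of_lt_of_le hji (hs' _ _ hr hi))

lemma good_descents {N κ : ℕ} (hN : 1 ≤ N) (f : Fin N → Fin (κ + 1)) (hf : GoodWord f) :
    descents (Tuple.sort f) = κ := by
  rw [descents_eq]
  obtain ⟨M, rfl⟩ : ∃ M, N = M + 1 := ⟨N - 1, by omega⟩
  rw [desBelow_succ_neg _ _ (by rintro ⟨h, _⟩; omega), ← good_val f hf M (by omega)]
  have hlt := (f (Tuple.sort f ⟨M, by omega⟩)).2
  rcases Nat.eq_zero_or_pos κ with h0 | h0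
  · omega
  · obtain ⟨i, j, -, hj, -⟩ := hf (κ - 1) (by omega)
    have h1 : f (Tuple.sort f ((Tuple.sort f).symm j)) ≤ f (Tuple.sort f ⟨M, by omega⟩) :=
      Tuple.monotone_sort f (Nat.lt_succ_iff.mp ((Tuple.sort f).symm j).2 :
        (Tuple.sort f).symm j ≤ ⟨M, by omega⟩)
    rw [Equiv.apply_symm_apply] at h1
    have h1' : (f j : ℕ) ≤ f (Tuple.sort f ⟨M, by omega⟩) := h1
    omega

open Classical in
lemma card_good_le {N κ : ℕ} (hN : 1 ≤ N) :
    (Finset.univ.filter (fun f : Fin N → Fin (κ + 1) => GoodWord f)).card ≤ eulerian N κ := by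
  rw [← Fintype.card_subtype]
  unfold eulerian
  rw [Nat.card_eq_fintype_card]
  refine Fintype.card_le_of_injective
    (fun f => ⟨Tuple.sort f.1, good_descents hN f.1 f.2⟩) ?_
  intro f g hfg
  simp only [Subtype.mk.injEq] at hfg
  apply Subtype.ext
  funext v
  obtain ⟨p, rfl⟩ := (Tuple.sort f.1).surjective v
  apply Fin.ext
  have h1 := good_val f.1 f.2 p.1 p.2
  have h2 := good_val g.1 g.2 p.1 p.2
  rw [← hfg] at h2
  exact h1.trans h2.symm

/-- Splitting the letter `c` of a word at the threshold `t`. -/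
def splitWord {N κ : ℕ} (x : Fin κ × Fin (N + 1) × (Fin N → Fin κ)) : Fin N → Fin (κ + 1) :=
  fun v => if x.2.2 v < x.1 ∨ (x.2.2 v = x.1 ∧ v.1 < x.2.1.1) then (x.2.2 v).castSucc
    else (x.2.2 v).succ

lemma bad_split {N κ : ℕ} (f : Fin N → Fin (κ + 1)) (hf : ¬ GoodWord f) :
    ∃ x, splitWord x = f := by
  classical
  unfold GoodWord at hf
  push Not at hf
  obtain ⟨c, hc, h⟩ := hf
  let t := (Finset.univ.filter (fun i : Fin N => (f i : ℕ) = c)).sup (fun i => i.1 + 1)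
  have ht : t ≤ N := Finset.sup_le (fun i _ => i.2)
  have ht1 : ∀ i, (f i : ℕ) = c → i.1 < t := by
    intro i hi
    exact Finset.le_sup (f := fun i : Fin N => i.1 + 1) (by simpa using hi)
  have ht2 : ∀ j, (f j : ℕ) = c + 1 → t ≤ j.1 := by
    intro j hj
    apply Finset.sup_le
    intro i hi
    have hi' : (f i : ℕ) = c := by simpa using hi
    have h1 : i.1 ≤ j.1 := h i j hi' hj
    have h2 : i.1 ≠ j.1 := by
      intro e
      have := Fin.ext e
      subst this
      omega
    omega
  refine ⟨(⟨c, hc⟩, ⟨t, by omega⟩, fun v => ⟨if (f v : ℕ) ≤ c then f v else f v - 1, ?_⟩), ?_⟩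
  · have := (f v).2
    split_ifs <;> omega
  · funext v
    apply Fin.ext
    have h1 := ht1 v
    have h2 := ht2 v
    simp only [splitWord, Fin.mk_lt_mk, Fin.mk.injEq]
    split_ifs <;> simp <;> omega

lemma le_eulerian {N κ : ℕ} (hN : 1 ≤ N) :
    (κ + 1) ^ N ≤ eulerian N κ + κ * ((N + 1) * κ ^ N) := by
  classical
  have h1 := card_good_le (κ := κ) hN
  have h2 : (Finset.univ.filter (fun f : Fin N → Fin (κ + 1) => ¬ GoodWord f)).card
      ≤ κ * ((N + 1) * κ ^ N) := by
    calc _ ≤ ((Finset.univ : Finset (Fin κ × Fin (N + 1) × (Fin N → Fin κ))).image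
          splitWord).card := by
          apply Finset.card_le_card
          intro f hf
          obtain ⟨x, hx⟩ := bad_split f (by simpa using hf)
          exact Finset.mem_image.mpr ⟨x, Finset.mem_univ _, hx⟩
      _ ≤ _ := Finset.card_image_le
      _ = _ := by simp
  have h3 := Finset.card_filter_add_card_filter_not
    (s := (Finset.univ : Finset (Fin N → Fin (κ + 1)))) (fun f => GoodWord f)
  have h4 : (Finset.univ : Finset (Fin N → Fin (κ + 1))).card = (κ + 1) ^ N := by simp
  omega

lemma tendsto_poly_geom (a b : ℕ) (h : a < b) (d : ℕ) :
    Filter.Tendsto (fun N : ℕ => ((N : ℝ) + 1) ^ d * (a : ℝ) ^ N / (b : ℝ) ^ N)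
      Filter.atTop (nhds 0) := by
  have hb : (0 : ℝ) < b := by exact_mod_cast (by omega : 0 < b)
  have hr : |(a : ℝ) / b| < 1 := by
    rw [abs_of_nonneg (by positivity), div_lt_one hb]
    exact_mod_cast h
  have h0 := (tendsto_pow_const_mul_const_pow_of_abs_lt_one d hr).const_mul ((2 : ℝ) ^ d)
  rw [mul_zero] at h0
  refine squeeze_zero' (Filter.Eventually.of_forall fun N => by positivity) ?_ h0
  filter_upwards [Filter.eventually_ge_atTop 1] with N hN
  have hN' : (1 : ℝ) ≤ N := by exact_mod_cast hN
  rw [mul_div_assoc, ← div_pow, ← mul_assoc, ← mul_pow]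
  gcongr
  linarith

lemma tendsto_eulerian (κ : ℕ) :
    Filter.Tendsto (fun N : ℕ => (eulerian N κ : ℝ) / ((κ : ℝ) + 1) ^ N)
      Filter.atTop (nhds 1) := by
  have h0 := (tendsto_poly_geom κ (κ + 1) (by omega) 1).const_mul (κ : ℝ)
  have h1 := (tendsto_const_nhds (x := (1 : ℝ)) (f := Filter.atTop (α := ℕ))).sub h0
  rw [mul_zero, sub_zero] at h1
  refine tendsto_of_tendsto_of_tendsto_of_le_of_le' h1 tendsto_const_nhds ?_ ?_
  · filter_upwards [Filter.eventually_ge_atTop 1] with N hN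
    have h : (((κ + 1) ^ N : ℕ) : ℝ) ≤ ((eulerian N κ + κ * ((N + 1) * κ ^ N) : ℕ) : ℝ) := by
      exact_mod_cast le_eulerian (κ := κ) hN
    push_cast at h ⊢
    have hp : (0 : ℝ) < ((κ : ℝ) + 1) ^ N := by positivity
    rw [le_div_iff₀ hp, sub_mul, one_mul, mul_assoc, div_mul_cancel₀ _ hp.ne', pow_one]
    linarith
  · refine Filter.Eventually.of_forall fun N => ?_
    have hp : (0 : ℝ) < ((κ : ℝ) + 1) ^ N := by positivity
    rw [div_le_one hp]
    exact_mod_cast eulerian_le N κ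

/-- The closed form for the unnormalized truncated solution. -/
noncomputable def closedForm (N κ m j : ℕ) : ℝ :=
  ∑ i ∈ Finset.range (κ + 1), (-1 : ℝ) ^ i * ((N + 1).choose i : ℝ) *
    ((κ - i : ℕ) + 1 : ℝ) ^ (N - m) * ((m + (κ - i) - j).choose m : ℝ)

lemma choose_rec (m a j : ℕ) (hj : j + 1 ≤ m) :
    ((a : ℝ) + 1) * ((m + a - j).choose m : ℝ) =
      ((j : ℝ) + 1) * ((m + 1 + a - j).choose (m + 1) : ℝ) +
      ((m : ℝ) - j) * ((m + 1 + a - (j + 1)).choose (m + 1) : ℝ) := by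
  obtain ⟨x, hx⟩ : ∃ x, x = m + a - j := ⟨_, rfl⟩
  have e1 : m + 1 + a - j = x + 1 := by omega
  have e2 : m + 1 + a - (j + 1) = x := by omega
  rw [e1, e2, ← hx, Nat.choose_succ_succ]
  push_cast
  have hxr : (x : ℝ) = m + a - j := by
    have : x + j = m + a := by omega
    have : (x : ℝ) + j = m + a := by exact_mod_cast this
    linarith
  have key : ((m : ℝ) + 1) * (x.choose (m + 1) : ℝ) = ((a : ℝ) - j) * (x.choose m : ℝ) := by
    rcases lt_or_ge x m with h | h
    · rw [Nat.choose_eq_zero_of_lt h, Nat.choose_eq_zero_of_lt (by omega)]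
      simp
    · have := Nat.choose_succ_right_eq x m
      have h2 : ((x.choose (m + 1) : ℝ)) * ((m : ℝ) + 1) = (x.choose m : ℝ) * ((x : ℝ) - m) := by
        rw [← Nat.cast_sub h]
        exact_mod_cast this
      rw [hxr] at h2
      linarith
  linear_combination -key

lemma closedForm_rec (N κ m j : ℕ) (hm : m + 1 ≤ N) (hj : j + 1 ≤ m) :
    closedForm N κ m j = ((j : ℝ) + 1) * closedForm N κ (m + 1) j +
      ((m : ℝ) - j) * closedForm N κ (m + 1) (j + 1) := by
  unfold closedForm
  rw [Finset.mul_sum, Finset.mul_sum, ← Finset.sum_add_distrib]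
  refine Finset.sum_congr rfl fun i _ => ?_
  have e : N - m = (N - (m + 1)) + 1 := by omega
  rw [e, pow_succ]
  linear_combination (-1 : ℝ) ^ i * ((N + 1).choose i : ℝ) *
    ((κ - i : ℕ) + 1 : ℝ) ^ (N - (m + 1)) * choose_rec m (κ - i) j hj

lemma alt_conv (N s : ℕ) :
    ∑ i ∈ Finset.range (s + 1), (-1 : ℝ) ^ i * ((N + 1).choose i : ℝ) *
      ((N + (s - i)).choose N : ℝ) = if s = 0 then 1 else 0 := by
  have h := congrArg (PowerSeries.coeff s)
    (PowerSeries.mk_add_choose_mul_one_sub_pow_eq_one ℝ N)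
  rw [mul_comm, PowerSeries.coeff_mul, PowerSeries.coeff_one,
    Finset.Nat.sum_antidiagonal_eq_sum_range_succ_mk] at h
  rw [← h]
  refine Finset.sum_congr rfl fun i _ => ?_
  rw [PowerSeries.coeff_mk]
  congr 1
  have : ((1 - PowerSeries.X : PowerSeries ℝ)) ^ (N + 1) =
      (((1 - Polynomial.X : Polynomial ℝ) ^ (N + 1) : Polynomial ℝ) : PowerSeries ℝ) := by
    simp
  rw [this, Polynomial.coeff_coe]
  have h2 : (1 - Polynomial.X : Polynomial ℝ) ^ (N + 1) =
      ((1 + Polynomial.X : Polynomial ℝ) ^ (N + 1)).comp (Polynomial.C (-1) * Polynomial.X) := by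
    simp [sub_eq_add_neg]
  rw [h2, Polynomial.comp_C_mul_X_coeff, Polynomial.coeff_one_add_X_pow]
  ring

lemma closedForm_top (N κ j : ℕ) (hj : j + 1 ≤ N) :
    closedForm N κ N j = if j = κ then 1 else 0 := by
  unfold closedForm
  rcases lt_or_ge κ j with h | h
  · rw [if_neg (by omega)]
    refine Finset.sum_eq_zero fun i _ => ?_
    rw [Nat.choose_eq_zero_of_lt (by omega : N + (κ - i) - j < N)]
    simp
  · obtain ⟨s, rfl⟩ := Nat.exists_eq_add_of_le h
    have := alt_conv N s
    rw [show (if j = j + s then (1 : ℝ) else 0) = if s = 0 then 1 else 0 by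
      congr 1; simp, ← this]
    symm
    apply Finset.sum_subset_zero_on_sdiff
    · intro i hi
      simp only [Finset.mem_range] at hi ⊢
      omega
    · intro i hi
      simp only [Finset.mem_sdiff, Finset.mem_range] at hi
      rw [Nat.choose_eq_zero_of_lt (by omega : N + (j + s - i) - j < N)]
      simp
    · intro i hi
      simp only [Finset.mem_range] at hi
      rw [show N + (j + s - i) - j = N + (s - i) by omega]
      simp

lemma trunc_eq (N κ : ℕ) (V : ℕ → ℕ → ℝ) (hV : IsTrunc N κ V) (d : ℕ) :
    ∀ m j, m + d = N → j + 1 ≤ m → V m j = closedForm N κ m j / (eulerian N κ : ℝ) := by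
  induction d with
  | zero =>
    intro m j hm hj
    obtain rfl : m = N := by omega
    rw [hV.1 j (by omega), closedForm_top _ _ _ hj]
    split_ifs <;> simp
  | succ d ih =>
    intro m j hm hj
    rw [hV.2 m j (by omega) (by omega) (by omega), ih (m + 1) j (by omega) (by omega),
      ih (m + 1) (j + 1) (by omega) (by omega), closedForm_rec N κ m j (by omega) hj]
    ring

lemma tendsto_closedForm (κ n k : ℕ) :
    Filter.Tendsto (fun N => closedForm N κ n k / ((κ : ℝ) + 1) ^ N) Filter.atTop
      (nhds ((Nat.choose (n + κ - k) n : ℝ) / ((κ : ℝ) + 1) ^ n)) := by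
  have hlim : ∀ i ∈ Finset.range (κ + 1), Filter.Tendsto (fun N : ℕ =>
      (-1 : ℝ) ^ i * ((N + 1).choose i : ℝ) * ((κ - i : ℕ) + 1 : ℝ) ^ (N - n) *
        ((n + (κ - i) - k).choose n : ℝ) / ((κ : ℝ) + 1) ^ N) Filter.atTop
      (nhds (if i = 0 then (Nat.choose (n + κ - k) n : ℝ) / ((κ : ℝ) + 1) ^ n else 0)) := by
    intro i hi
    have hi' : i ≤ κ := by simpa [Nat.lt_succ_iff] using hi
    split_ifs with h0
    · subst h0
      refine tendsto_const_nhds.congr' ?_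
      filter_upwards [Filter.eventually_ge_atTop n] with N hN
      obtain ⟨M, rfl⟩ := Nat.exists_eq_add_of_le hN
      have : ((κ : ℝ) + 1) ≠ 0 := by positivity
      simp only [pow_zero, Nat.choose_zero_right, Nat.cast_one, Nat.sub_zero,
        Nat.add_sub_cancel_left, pow_add]
      field_simp
    · have hp := (tendsto_poly_geom (κ - i + 1) (κ + 1) (by omega) i).mul_const
        ((n + (κ - i) - k).choose n : ℝ)
      rw [zero_mul] at hp
      refine squeeze_zero_norm (fun N => ?_) hp
      rw [norm_div, norm_mul, norm_mul, norm_mul, norm_pow, norm_neg, norm_one, one_pow, one_mul,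
        Real.norm_of_nonneg (by positivity), Real.norm_of_nonneg (by positivity),
        Real.norm_of_nonneg (by positivity), Real.norm_of_nonneg (by positivity)]
      rw [div_mul_eq_mul_div]
      push_cast
      have hc : ((N + 1).choose i : ℝ) ≤ ((N : ℝ) + 1) ^ i := by
        exact_mod_cast Nat.choose_le_pow (N + 1) i
      have hq : (((κ - i : ℕ) : ℝ) + 1) ^ (N - n) ≤ (((κ - i : ℕ) : ℝ) + 1) ^ N :=
        pow_le_pow_right₀ (by linarith [Nat.cast_nonneg (α := ℝ) (κ - i)]) (by omega)
      gcongr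
  have := tendsto_finsetSum _ hlim
  rw [Finset.sum_ite_eq' (Finset.range (κ + 1)) 0, if_pos (by simp)] at this
  refine this.congr fun N => ?_
  rw [closedForm, Finset.sum_div]

theorem stmt4 (κ n k : ℕ) (hn : 1 ≤ n) (hk : k ≤ n - 1)
    (V : ℕ → ℕ → ℕ → ℝ)
    (hV : ∀ N : ℕ, max (n + 1) (κ + 1) ≤ N → IsTrunc N κ (V N)) :
    Filter.Tendsto (fun N => V N n k) Filter.atTop
      (nhds ((Nat.choose (n + κ - k) n : ℝ) / ((κ : ℝ) + 1) ^ n)) := by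
  have h := (tendsto_closedForm κ n k).div (tendsto_eulerian κ) one_ne_zero
  rw [div_one] at h
  refine h.congr' ?_
  filter_upwards [Filter.eventually_ge_atTop (max (n + 1) (κ + 1))] with N hN
  have hN' : n + 1 ≤ N := le_trans (le_max_left _ _) hN
  rw [trunc_eq N κ (V N) (hV N hN) (N - n) n k (by omega) (by omega)]
  have hp : ((κ : ℝ) + 1) ^ N ≠ 0 := by positivity
  exact div_div_div_cancel_right₀ hp _ _
end

section
/- A function W : ℕ → ℕ → ℝ is an extreme point of 𝒱 if and only if W = W^κ for some κ ∈ ℕ, or W = Ŵ^κ for some κ ∈ ℕ, or W = W^∞. -/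
/-- The convex set `𝒱` of nonnegative normalized solutions to the dual recursion. -/
def memV (V : ℕ → ℕ → ℝ) : Prop :=
  (∀ n k : ℕ, n = 0 ∨ n ≤ k → V n k = 0) ∧
  (∀ n k : ℕ, 0 ≤ V n k) ∧
  V 1 0 = 1 ∧
  (∀ n k : ℕ, 1 ≤ n → k ≤ n - 1 →
    V n k = ((k : ℝ) + 1) * V (n + 1) k + ((n : ℝ) - (k : ℝ)) * V (n + 1) (k + 1))

/-- The array `W^κ` produced by bucket sorting with `κ+1` buckets. -/
noncomputable def Wbucket (κ : ℕ) (n k : ℕ) : ℝ :=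
  if 1 ≤ n ∧ k ≤ n - 1 then (Nat.choose (n + κ - k) n : ℝ) / ((κ : ℝ) + 1) ^ n else 0

/-- The array `Ŵ^κ` (the image of `W^κ` under the symmetry of the triangle). -/
noncomputable def Whatbucket (κ : ℕ) (n k : ℕ) : ℝ :=
  if 1 ≤ n ∧ k ≤ n - 1 then (Nat.choose (κ + k + 1) n : ℝ) / ((κ : ℝ) + 1) ^ n else 0

/-- The array `W^∞` corresponding to the exchangeable random arrangement. -/
noncomputable def Winf (n k : ℕ) : ℝ :=
  if 1 ≤ n ∧ k ≤ n - 1 then 1 / (Nat.factorial n : ℝ) else 0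

/-- `W` is an extreme point of `𝒱`. -/
def ExtremePt (W : ℕ → ℕ → ℝ) : Prop :=
  memV W ∧ ∀ (t : ℝ) (V₁ V₂ : ℕ → ℕ → ℝ), memV V₁ → memV V₂ → 0 < t → t < 1 →
    (∀ n k : ℕ, W n k = t * V₁ n k + (1 - t) * V₂ n k) → V₁ = W ∧ V₂ = W

open Filter Topology

/-- Nonnegative solutions without normalization. -/
def ConeV (V : ℕ → ℕ → ℝ) : Prop :=
  (∀ n k : ℕ, n ≤ k → V n k = 0) ∧
  (∀ n k : ℕ, 0 ≤ V n k) ∧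
  (∀ n k : ℕ, k < n →
    V n k = ((k : ℝ) + 1) * V (n + 1) k + ((n : ℝ) - (k : ℝ)) * V (n + 1) (k + 1))

theorem memV_iff (V : ℕ → ℕ → ℝ) : memV V ↔ ConeV V ∧ V 1 0 = 1 := by
  constructor
  · rintro ⟨h1, h2, h3, h4⟩
    exact ⟨⟨fun n k h => h1 n k (Or.inr h), h2, fun n k h => h4 n k (by omega) (by omega)⟩, h3⟩
  · rintro ⟨⟨h1, h2, h4⟩, h3⟩
    refine ⟨fun n k h => h1 n k (by omega), h2, h3, fun n k h h' => h4 n k (by omega)⟩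

theorem cone_zero {V : ℕ → ℕ → ℝ} (h : ConeV V) (h0 : V 1 0 = 0) : ∀ n k, V n k = 0 := by
  obtain ⟨h1, h2, h4⟩ := h
  have key : ∀ n k, V (n + 1) k = 0 := by
    intro n
    induction n with
    | zero =>
      intro k
      rcases Nat.eq_zero_or_pos k with rfl | hk
      · simpa using h0
      · exact h1 _ _ (by omega)
    | succ n ih =>
      have aux : ∀ k, k < n + 1 → V (n + 2) k = 0 ∧ V (n + 2) (k + 1) = 0 := by
        intro k hk
        have e := h4 (n + 1) k hk
        rw [ih k] at e
        have a := h2 (n + 2) k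
        have b := h2 (n + 2) (k + 1)
        have hk' : (k : ℝ) + 1 ≤ ((n + 1 : ℕ) : ℝ) := by exact_mod_cast hk
        have hk0 : (0 : ℝ) ≤ k := Nat.cast_nonneg k
        have p1 : 0 ≤ (k : ℝ) * V (n + 2) k := mul_nonneg hk0 a
        have p2 : 0 ≤ (((n + 1 : ℕ) : ℝ) - k - 1) * V (n + 2) (k + 1) :=
          mul_nonneg (by linarith) b
        have e' : 0 = ((k : ℝ) + 1) * V (n + 2) k
          + (((n + 1 : ℕ) : ℝ) - (k : ℝ)) * V (n + 2) (k + 1) := e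
        constructor <;> nlinarith
      intro k
      rcases Nat.lt_or_ge k (n + 1) with hk | hk
      · exact (aux k hk).1
      · rcases Nat.eq_or_lt_of_le hk with rfl | hk
        · exact (aux n (by omega)).2
        · exact h1 _ _ (by omega)
  intro n k
  cases n with
  | zero => exact h1 _ _ (by omega)
  | succ n => exact key n k

/-- Scaled sequence is antitone when the neighbour column is nonnegative. -/
theorem col_step {f : ℕ → ℕ → ℝ} {k : ℕ}
    (hrec : ∀ n, k < n →
      f n k = ((k : ℝ) + 1) * f (n + 1) k + ((n : ℝ) - (k : ℝ)) * f (n + 1) (k + 1))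
    (hpos : ∀ n, 0 ≤ f n (k + 1)) {n m : ℕ} (hn : k < n) (hm : n ≤ m) :
    ((k : ℝ) + 1) ^ m * f m k ≤ ((k : ℝ) + 1) ^ n * f n k := by
  induction m, hm using Nat.le_induction with
  | base => exact le_rfl
  | succ m hm ih =>
    refine le_trans ?_ ih
    rw [hrec m (by omega), pow_succ]
    have hk' : (k : ℝ) ≤ m := by exact_mod_cast (by omega : k ≤ m)
    have : 0 ≤ ((k : ℝ) + 1) ^ m * (((m : ℝ) - k) * f (m + 1) (k + 1)) :=
      mul_nonneg (by positivity) (mul_nonneg (by linarith) (hpos _))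
    nlinarith

theorem col_nonneg {f : ℕ → ℕ → ℝ} {k : ℕ}
    (hrec : ∀ n, k < n →
      f n k = ((k : ℝ) + 1) * f (n + 1) k + ((n : ℝ) - (k : ℝ)) * f (n + 1) (k + 1))
    (hpos : ∀ n, 0 ≤ f n (k + 1)) {e : ℕ → ℝ} (he : Tendsto e atTop (𝓝 0))
    (hle : ∀ m, e m ≤ ((k : ℝ) + 1) ^ m * f m k) {n : ℕ} (hn : k < n) : 0 ≤ f n k := by
  have h : 0 ≤ ((k : ℝ) + 1) ^ n * f n k := by
    refine le_of_tendsto he ?_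
    filter_upwards [eventually_ge_atTop n] with m hm
    exact (hle m).trans (col_step hrec hpos hn hm)
  exact nonneg_of_mul_nonneg_right h (by positivity)

theorem exists_lim {V : ℕ → ℕ → ℝ} (h : ConeV V) (k : ℕ) :
    ∃ L : ℝ, 0 ≤ L ∧ Tendsto (fun n => ((k : ℝ) + 1) ^ n * V n k) atTop (𝓝 L) ∧
      ∀ n, k < n → L ≤ ((k : ℝ) + 1) ^ n * V n k := by
  obtain ⟨h1, h2, h4⟩ := h
  let g : ℕ → ℝ := fun n => ((k : ℝ) + 1) ^ (n + (k + 1)) * V (n + (k + 1)) k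
  have hg : Antitone g := fun a b hab =>
    col_step (fun n hn => h4 n k hn) (fun n => h2 _ _) (by omega) (by omega)
  have hg0 : ∀ n, 0 ≤ g n := fun n => mul_nonneg (by positivity) (h2 _ _)
  have hbd : BddBelow (Set.range g) := ⟨0, by rintro _ ⟨n, rfl⟩; exact hg0 n⟩
  have ht := tendsto_atTop_ciInf hg hbd
  refine ⟨⨅ i, g i, le_ciInf hg0, ?_, ?_⟩
  · exact (tendsto_add_atTop_iff_nat (f := fun n => ((k : ℝ) + 1) ^ n * V n k) (k + 1)).1 ht
  · intro n hn
    have := ciInf_le hbd (n - (k + 1))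
    have e : n - (k + 1) + (k + 1) = n := by omega
    simpa only [g, e] using this

theorem Wb_eq (κ : ℕ) {n k : ℕ} (h : k < n) :
    Wbucket κ n k = (Nat.choose (n + κ - k) n : ℝ) / ((κ : ℝ) + 1) ^ n := by
  unfold Wbucket; rw [if_pos (by omega)]

theorem Wb_zero (κ : ℕ) {n k : ℕ} (h : n ≤ k) : Wbucket κ n k = 0 := by
  unfold Wbucket; rw [if_neg (by omega)]

theorem Wb_zero' (κ : ℕ) {n k : ℕ} (h : κ < k) : Wbucket κ n k = 0 := by
  rcases Nat.lt_or_ge k n with hk | hk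
  · rw [Wb_eq κ hk, Nat.choose_eq_zero_of_lt (by omega)]; simp
  · exact Wb_zero κ hk

theorem Wb_diag (κ : ℕ) {n : ℕ} (h : κ < n) : Wbucket κ n κ = 1 / ((κ : ℝ) + 1) ^ n := by
  rw [Wb_eq κ h]; simp

theorem choose_real (a n : ℕ) :
    ((n : ℝ) + 1) * (Nat.choose a (n + 1) : ℝ) = ((a : ℝ) - n) * (Nat.choose a n : ℝ) := by
  rcases Nat.lt_or_ge a n with h | h
  · rw [Nat.choose_eq_zero_of_lt h, Nat.choose_eq_zero_of_lt (by omega)]; simp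
  · have := Nat.choose_succ_right_eq a n
    have h2 : ((Nat.choose a (n + 1) * (n + 1) : ℕ) : ℝ) = ((Nat.choose a n * (a - n) : ℕ) : ℝ) := by
      rw [this]
    push_cast [Nat.cast_sub h] at h2
    linarith

theorem Wb_cone (κ : ℕ) : ConeV (Wbucket κ) := by
  refine ⟨fun n k h => Wb_zero κ h, ?_, ?_⟩
  · intro n k; unfold Wbucket; split_ifs <;> positivity
  · intro n k h
    rw [Wb_eq κ h, Wb_eq κ (by omega : k < n + 1), Wb_eq κ (by omega : k + 1 < n + 1)]
    obtain ⟨a, ha⟩ : ∃ a, a = n + κ - k := ⟨_, rfl⟩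
    have e1 : n + 1 + κ - k = a + 1 := by omega
    have e2 : n + 1 + κ - (k + 1) = a := by omega
    have ha' : (a : ℝ) = (n : ℝ) + κ - k := by
      rw [ha, Nat.cast_sub (by omega)]; push_cast; ring
    rw [e1, e2, ← ha, Nat.choose_succ_succ, pow_succ]
    have c := choose_real a n
    rw [ha'] at c
    push_cast
    have hp : ((κ : ℝ) + 1) ^ n ≠ 0 := by positivity
    have hq : (κ : ℝ) + 1 ≠ 0 := by positivity
    field_simp
    linarith

theorem Wb_mem (κ : ℕ) : memV (Wbucket κ) := by
  refine (memV_iff _).2 ⟨Wb_cone κ, ?_⟩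
  rw [Wb_eq κ (by omega)]
  have : (κ : ℝ) + 1 ≠ 0 := by positivity
  simp only [Nat.choose_one_right, pow_one, Nat.sub_zero]
  push_cast
  rw [div_eq_one_iff_eq this]; ring

theorem Wb_tendsto {k κ : ℕ} (h : k ≠ κ) :
    Tendsto (fun n => ((k : ℝ) + 1) ^ n * Wbucket κ n k) atTop (𝓝 0) := by
  rcases Nat.lt_or_gt_of_ne h with h | h
  · set j := κ - k with hj
    have hr : |((k : ℝ) + 1) / ((κ : ℝ) + 1)| < 1 := by
      rw [abs_of_nonneg (by positivity), div_lt_one (by positivity)]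
      have : (k : ℝ) < κ := by exact_mod_cast h
      linarith
    have T := (tendsto_pow_const_mul_const_pow_of_abs_lt_one j hr).const_mul (((1 + j : ℕ) : ℝ) ^ j)
    rw [mul_zero] at T
    refine tendsto_of_tendsto_of_tendsto_of_le_of_le' tendsto_const_nhds T ?_ ?_
    · exact Eventually.of_forall fun n => mul_nonneg (by positivity) ((Wb_cone κ).2.1 _ _)
    · filter_upwards [eventually_gt_atTop k] with n hn
      rw [Wb_eq κ hn]
      have e : n + κ - k = n + j := by omega
      have c : (Nat.choose (n + κ - k) n : ℝ) ≤ ((1 + j : ℕ) : ℝ) ^ j * (n : ℝ) ^ j := by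
        rw [e, ← mul_pow]
        have : Nat.choose (n + j) n ≤ ((1 + j) * n) ^ j := by
          rw [Nat.choose_symm_add]
          refine (Nat.choose_le_pow _ _).trans (Nat.pow_le_pow_left ?_ j)
          nlinarith
        exact_mod_cast this
      rw [div_pow]
      calc ((k : ℝ) + 1) ^ n * ((Nat.choose (n + κ - k) n : ℝ) / ((κ : ℝ) + 1) ^ n)
          = (Nat.choose (n + κ - k) n : ℝ) * (((k : ℝ) + 1) ^ n / ((κ : ℝ) + 1) ^ n) := by ring
        _ ≤ (((1 + j : ℕ) : ℝ) ^ j * (n : ℝ) ^ j) * (((k : ℝ) + 1) ^ n / ((κ : ℝ) + 1) ^ n) :=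
            mul_le_mul_of_nonneg_right c (by positivity)
        _ = _ := by ring
  · simp only [Wb_zero' κ h, mul_zero]; exact tendsto_const_nhds

theorem sub_cone {V : ℕ → ℕ → ℝ} (h : ConeV V) (κ : ℕ) {L : ℝ} (hL : 0 ≤ L)
    (hLe : ∀ n, κ < n → L ≤ ((κ : ℝ) + 1) ^ n * V n κ) :
    ConeV (fun n k => V n k - L * Wbucket κ n k) := by
  obtain ⟨h1, h2, h4⟩ := h
  obtain ⟨w1, w2, w4⟩ := Wb_cone κ
  have hrec : ∀ n k : ℕ, k < n → V n k - L * Wbucket κ n k =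
      ((k : ℝ) + 1) * (V (n + 1) k - L * Wbucket κ (n + 1) k) +
      ((n : ℝ) - (k : ℝ)) * (V (n + 1) (k + 1) - L * Wbucket κ (n + 1) (k + 1)) := by
    intro n k hk
    have a := h4 n k hk
    have b := w4 n k hk
    rw [a, b]; ring
  have main : ∀ j k, k + j = κ → ∀ n, 0 ≤ V n k - L * Wbucket κ n k := by
    intro j
    induction j with
    | zero =>
      intro k hk n
      obtain rfl : k = κ := by omega
      rcases Nat.lt_or_ge k n with hn | hn
      · rw [Wb_diag k hn]
        have := hLe n hn
        have hp : (0 : ℝ) < ((k : ℝ) + 1) ^ n := by positivity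
        have : L / ((k : ℝ) + 1) ^ n ≤ V n k := by
          rw [div_le_iff₀ hp]; linarith
        rw [mul_one_div]; linarith
      · rw [h1 _ _ hn, w1 _ _ hn]; simp
    | succ j ih =>
      intro k hk n
      rcases Nat.lt_or_ge k n with hn | hn
      · have T := (Wb_tendsto (k := k) (κ := κ) (by omega)).const_mul (-L)
        rw [mul_zero] at T
        refine col_nonneg (f := fun n k => V n k - L * Wbucket κ n k) (fun n hn => hrec n k hn)
          (fun n => ih (k + 1) (by omega) n) T ?_ hn
        intro m
        have : 0 ≤ ((k : ℝ) + 1) ^ m * V m k := mul_nonneg (by positivity) (h2 _ _)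
        nlinarith
      · rw [h1 _ _ hn, w1 _ _ hn]; simp
  refine ⟨fun n k h => ?_, fun n k => ?_, hrec⟩
  · simp only [h1 _ _ h, w1 _ _ h]; simp
  · rcases Nat.lt_or_ge κ k with hk | hk
    · simp only [Wb_zero' κ hk]; simpa using h2 n k
    · exact main (κ - k) k (by omega) n

theorem vanish {V : ℕ → ℕ → ℝ} (h : ConeV V) (κ : ℕ) (hz : ∀ n k, κ < k → V n k = 0)
    (hT : ∀ k : ℕ, Tendsto (fun n => ((k : ℝ) + 1) ^ n * V n k) atTop (𝓝 0)) :
    ∀ n k, V n k = 0 := by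
  obtain ⟨h1, h2, h4⟩ := h
  have main : ∀ j k, k + j = κ + 1 → ∀ n, V n k = 0 := by
    intro j
    induction j with
    | zero => intro k hk n; exact hz n k (by omega)
    | succ j ih =>
      intro k hk n
      rcases Nat.lt_or_ge k n with hn | hn
      · have T := (hT k).neg
        rw [neg_zero] at T
        have : 0 ≤ -V n k := by
          refine col_nonneg (f := fun n k => -V n k) (fun n hn => ?_)
            (fun n => ?_) T ?_ hn
          · rw [h4 n k hn]; ring
          · rw [ih (k + 1) (by omega) n]; simp
          · intro m; simp
        exact le_antisymm (by linarith) (h2 _ _)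
      · exact h1 _ _ hn
  intro n k
  rcases Nat.lt_or_ge κ k with hk | hk
  · exact hz n k hk
  · exact main (κ + 1 - k) k (by omega) n

/-- Minimality of `W` in the cone. -/
theorem extreme_of_min {W : ℕ → ℕ → ℝ} (hW : memV W)
    (hmin : ∀ (V : ℕ → ℕ → ℝ) (c : ℝ), memV V → (∀ n k, V n k ≤ c * W n k) → V = W) :
    ExtremePt W := by
  refine ⟨hW, fun t V₁ V₂ h1 h2 t0 t1 h => ⟨hmin V₁ (1 / t) h1 ?_, hmin V₂ (1 / (1 - t)) h2 ?_⟩⟩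
  · intro n k
    have a := h2.2.1 n k
    have : 0 ≤ (1 - t) * V₂ n k := mul_nonneg (by linarith) a
    rw [one_div, ← div_eq_inv_mul, le_div_iff₀ t0, h n k]; linarith
  · intro n k
    have a := h1.2.1 n k
    have : 0 ≤ t * V₁ n k := mul_nonneg (by linarith) a
    rw [one_div, ← div_eq_inv_mul, le_div_iff₀ (by linarith), h n k]; linarith

theorem tendsto_dom {V W : ℕ → ℕ → ℝ} (hV : ∀ n k, 0 ≤ V n k) {c : ℝ}
    (h : ∀ n k, V n k ≤ c * W n k) {k : ℕ}
    (hT : Tendsto (fun n => ((k : ℝ) + 1) ^ n * W n k) atTop (𝓝 0)) :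
    Tendsto (fun n => ((k : ℝ) + 1) ^ n * V n k) atTop (𝓝 0) := by
  have T := hT.const_mul c
  rw [mul_zero] at T
  refine squeeze_zero (fun n => mul_nonneg (by positivity) (hV _ _)) (fun n => ?_) T
  have : (0 : ℝ) ≤ ((k : ℝ) + 1) ^ n := by positivity
  calc ((k : ℝ) + 1) ^ n * V n k ≤ ((k : ℝ) + 1) ^ n * (c * W n k) :=
        mul_le_mul_of_nonneg_left (h n k) this
    _ = _ := by ring

theorem Wb_extreme (κ : ℕ) : ExtremePt (Wbucket κ) := by
  refine extreme_of_min (Wb_mem κ) fun V c hV hc => ?_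
  obtain ⟨hC, hN⟩ := (memV_iff V).1 hV
  obtain ⟨L, L0, LT, Lle⟩ := exists_lim hC κ
  have hD := sub_cone hC κ L0 Lle
  have hz := vanish hD κ (fun n k hk => ?_) (fun k => ?_)
  · have e := hz 1 0
    have w := (Wb_mem κ).2.2.1
    simp only [hN, w] at e
    have : L = 1 := by linarith
    subst this
    funext n k
    have := hz n k
    linarith
  · have a := hc n k
    rw [Wb_zero' κ hk, mul_zero] at a
    simp only [Wb_zero' κ hk, mul_zero, sub_zero]
    exact le_antisymm a (hC.2.1 _ _)
  · by_cases hk : k = κ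
    · subst hk
      have T := LT.sub_const L
      rw [sub_self] at T
      refine T.congr' ?_
      filter_upwards [eventually_gt_atTop k] with n hn
      rw [Wb_diag k hn]
      have : ((k : ℝ) + 1) ^ n ≠ 0 := by positivity
      field_simp
    · have T1 := tendsto_dom hC.2.1 hc (Wb_tendsto hk)
      have T := T1.sub ((Wb_tendsto hk).const_mul L)
      rw [mul_zero, sub_zero] at T
      refine T.congr fun n => ?_
      ring

/-- Peeling off a component of an extreme point. -/
theorem extreme_peel {W V : ℕ → ℕ → ℝ} (hW : ExtremePt W) (hV : memV V) {L : ℝ} (hL : 0 < L)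
    (hD : ConeV (fun n k => W n k - L * V n k)) : W = V := by
  obtain ⟨hM, hE⟩ := hW
  obtain ⟨hC, hN⟩ := (memV_iff W).1 hM
  obtain ⟨hC', hN'⟩ := (memV_iff V).1 hV
  have L1 : L ≤ 1 := by
    have := hD.2.1 1 0
    simp only [hN, hN'] at this
    linarith
  have hp : (0 : ℝ) < 1 - L / 2 := by linarith
  refine (hE (L / 2) V (fun n k => (W n k - L / 2 * V n k) / (1 - L / 2)) hV ?_
    (by linarith) (by linarith) ?_).1.symm
  · refine (memV_iff _).2 ⟨⟨fun n k h => ?_, fun n k => ?_, fun n k h => ?_⟩, ?_⟩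
    · simp only [hC.1 _ _ h, hC'.1 _ _ h]; simp
    · have a := hD.2.1 n k
      have b := mul_nonneg hL.le (hC'.2.1 n k)
      simp only at a ⊢
      exact div_nonneg (by linarith) hp.le
    · simp only
      rw [hC.2.2 n k h, hC'.2.2 n k h]; ring
    · simp only [hN, hN']; rw [mul_one]; exact div_self hp.ne'
  · intro n k
    rw [mul_div_cancel₀ _ hp.ne']
    ring

/-- Reflection. -/
def refl' (V : ℕ → ℕ → ℝ) : ℕ → ℕ → ℝ := fun n k => if k < n then V n (n - 1 - k) else 0

theorem refl_cone {V : ℕ → ℕ → ℝ} (h : ConeV V) : ConeV (refl' V) := by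
  obtain ⟨h1, h2, h4⟩ := h
  refine ⟨fun n k h => ?_, fun n k => ?_, fun n k h => ?_⟩
  · unfold refl'; rw [if_neg (by omega)]
  · unfold refl'; split_ifs
    · exact h2 _ _
    · exact le_rfl
  · unfold refl'
    rw [if_pos h, if_pos (by omega), if_pos (by omega)]
    obtain ⟨j, rfl⟩ : ∃ j, n = k + j + 1 := ⟨n - k - 1, by omega⟩
    have e1 : k + j + 1 - 1 - k = j := by omega
    have e2 : k + j + 1 + 1 - 1 - k = j + 1 := by omega
    have e3 : k + j + 1 + 1 - 1 - (k + 1) = j := by omega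
    rw [e1, e2, e3, h4 _ j (by omega)]
    push_cast
    ring

theorem refl_refl {V : ℕ → ℕ → ℝ} (h : ConeV V) : refl' (refl' V) = V := by
  funext n k
  unfold refl'
  rcases Nat.lt_or_ge k n with hk | hk
  · rw [if_pos hk, if_pos (by omega)]; congr 1; omega
  · rw [if_neg (by omega), h.1 _ _ hk]

theorem refl_mem {V : ℕ → ℕ → ℝ} (h : memV V) : memV (refl' V) := by
  obtain ⟨hC, hN⟩ := (memV_iff V).1 h
  refine (memV_iff _).2 ⟨refl_cone hC, ?_⟩
  simpa [refl'] using hN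

theorem refl_extreme {W : ℕ → ℕ → ℝ} (h : ExtremePt W) : ExtremePt (refl' W) := by
  have hC := ((memV_iff W).1 h.1).1
  refine ⟨refl_mem h.1, fun t V₁ V₂ h1 h2 t0 t1 e => ?_⟩
  have c1 := ((memV_iff _).1 h1).1
  have c2 := ((memV_iff _).1 h2).1
  obtain ⟨a, b⟩ := h.2 t (refl' V₁) (refl' V₂) (refl_mem h1) (refl_mem h2) t0 t1 (fun n k => by
    rw [← refl_refl hC]
    unfold refl' at e ⊢
    by_cases hk : k < n
    · simp only [if_pos hk]; exact e _ _
    · simp [if_neg hk])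
  exact ⟨by rw [← a, refl_refl c1], by rw [← b, refl_refl c2]⟩

theorem What_eq (κ : ℕ) : Whatbucket κ = refl' (Wbucket κ) := by
  funext n k
  unfold refl'
  rcases Nat.lt_or_ge k n with hk | hk
  · rw [if_pos hk, Wb_eq κ (by omega)]
    unfold Whatbucket
    rw [if_pos (by omega)]
    have : n + κ - (n - 1 - k) = κ + k + 1 := by omega
    rw [this]
  · rw [if_neg (by omega)]
    unfold Whatbucket
    rw [if_neg (by omega)]

theorem Winf_eq {n k : ℕ} (h : k < n) : Winf n k = 1 / (Nat.factorial n : ℝ) := by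
  unfold Winf; rw [if_pos (by omega)]

theorem Winf_mem : memV Winf := by
  refine (memV_iff _).2 ⟨⟨fun n k h => ?_, fun n k => ?_, fun n k h => ?_⟩, ?_⟩
  · unfold Winf; rw [if_neg (by omega)]
  · unfold Winf; split_ifs <;> positivity
  · rw [Winf_eq h, Winf_eq (by omega), Winf_eq (by omega), Nat.factorial_succ]
    push_cast
    have : (Nat.factorial n : ℝ) ≠ 0 := by positivity
    have : (n : ℝ) + 1 ≠ 0 := by positivity
    field_simp
    ring
  · rw [Winf_eq (by omega)]; simp

theorem Winf_refl : refl' Winf = Winf := by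
  funext n k
  unfold refl'
  rcases Nat.lt_or_ge k n with hk | hk
  · rw [if_pos hk, Winf_eq hk, Winf_eq (by omega)]
  · rw [if_neg (by omega)]; unfold Winf; rw [if_neg (by omega)]

theorem Winf_tendsto (k : ℕ) :
    Tendsto (fun n => ((k : ℝ) + 1) ^ n * Winf n k) atTop (𝓝 0) := by
  refine (FloorSemiring.tendsto_pow_div_factorial_atTop ((k : ℝ) + 1)).congr' ?_
  filter_upwards [eventually_gt_atTop k] with n hn
  rw [Winf_eq hn]; ring

/-- Eulerian numbers, level `n+1`. -/
noncomputable def EA : ℕ → ℕ → ℝ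
  | 0, k => if k = 0 then 1 else 0
  | n + 1, 0 => EA n 0
  | n + 1, k + 1 => ((k : ℝ) + 2) * EA n (k + 1) + (((n : ℝ) + 1) - k) * EA n k

theorem EA_zero : ∀ n k, n < k → EA n k = 0 := by
  intro n
  induction n with
  | zero => intro k hk; simp [EA]; omega
  | succ n ih =>
    intro k hk
    obtain ⟨k, rfl⟩ : ∃ j, k = j + 1 := ⟨k - 1, by omega⟩
    simp [EA, ih k (by omega), ih (k + 1) (by omega)]

theorem EA_nonneg : ∀ n k, 0 ≤ EA n k := by
  intro n
  induction n with
  | zero => intro k; simp only [EA]; split_ifs <;> norm_num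
  | succ n ih =>
    intro k
    cases k with
    | zero => simpa [EA] using ih 0
    | succ k =>
      rcases Nat.lt_or_ge n k with hk | hk
      · rw [EA_zero _ _ (by omega)]
      · have : (k : ℝ) ≤ n := by exact_mod_cast hk
        exact add_nonneg (mul_nonneg (by positivity) (ih _)) (mul_nonneg (by linarith) (ih _))

theorem EA_pos : ∀ n k, k ≤ n → 0 < EA n k := by
  intro n
  induction n with
  | zero => intro k hk; simp only [EA]; rw [if_pos (by omega)]; norm_num
  | succ n ih =>
    intro k hk
    cases k with
    | zero => simpa [EA] using ih 0 (by omega)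
    | succ k =>
      have : (k : ℝ) ≤ n := by exact_mod_cast (by omega : k ≤ n)
      exact add_pos_of_nonneg_of_pos (mul_nonneg (by positivity) (EA_nonneg _ _))
        (mul_pos (by linarith) (ih _ (by omega)))

theorem EA_le1 (n k : ℕ) (hk : k ≤ n) : ((k : ℝ) + 1) * EA n k ≤ EA (n + 1) k := by
  cases k with
  | zero => simp [EA]
  | succ k =>
    have : (k : ℝ) ≤ n := by exact_mod_cast (by omega : k ≤ n)
    have h := mul_nonneg (by linarith : 0 ≤ (n : ℝ) + 1 - k) (EA_nonneg n k)
    simp only [EA]; push_cast; linarith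

theorem EA_le2 (n k : ℕ) : ((n : ℝ) + 1 - k) * EA n k ≤ EA (n + 1) (k + 1) := by
  have h := mul_nonneg (by positivity : 0 ≤ (k : ℝ) + 2) (EA_nonneg n (k + 1))
  simp only [EA]; linarith

theorem EA_sum (n : ℕ) (g : ℕ → ℝ) :
    ∑ k ∈ Finset.range (n + 1), EA n k * (((k : ℝ) + 1) * g k + ((n : ℝ) + 1 - k) * g (k + 1))
      = ∑ k ∈ Finset.range (n + 2), EA (n + 1) k * g k := by
  rw [Finset.sum_range_succ' (fun k => EA (n + 1) k * g k)]
  have a : ∑ k ∈ Finset.range (n + 1), EA n k * (((k : ℝ) + 1) * g k)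
      = ∑ k ∈ Finset.range (n + 1), ((k : ℝ) + 2) * EA n (k + 1) * g (k + 1) + EA n 0 * g 0 := by
    have e := Finset.sum_range_succ (fun k => EA n k * (((k : ℝ) + 1) * g k)) (n + 1)
    rw [EA_zero n (n + 1) (by omega), zero_mul, add_zero] at e
    rw [← e, Finset.sum_range_succ']
    congr 1
    · refine Finset.sum_congr rfl fun k _ => ?_
      push_cast; ring
    · simp
  have l : ∑ k ∈ Finset.range (n + 1),
      EA n k * (((k : ℝ) + 1) * g k + ((n : ℝ) + 1 - k) * g (k + 1)) =
      ∑ k ∈ Finset.range (n + 1), EA n k * (((k : ℝ) + 1) * g k) +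
      ∑ k ∈ Finset.range (n + 1), EA n k * (((n : ℝ) + 1 - k) * g (k + 1)) := by
    rw [← Finset.sum_add_distrib]
    exact Finset.sum_congr rfl fun k _ => mul_add _ _ _
  have r : ∑ k ∈ Finset.range (n + 1), EA (n + 1) (k + 1) * g (k + 1) =
      ∑ k ∈ Finset.range (n + 1), ((k : ℝ) + 2) * EA n (k + 1) * g (k + 1) +
      ∑ k ∈ Finset.range (n + 1), EA n k * (((n : ℝ) + 1 - k) * g (k + 1)) := by
    rw [← Finset.sum_add_distrib]
    refine Finset.sum_congr rfl fun k _ => ?_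
    simp only [EA]; ring
  have z : EA (n + 1) 0 = EA n 0 := by simp only [EA]
  rw [l, r, a, z]; ring

theorem EA_total {V : ℕ → ℕ → ℝ} (h : memV V) (n : ℕ) :
    ∑ k ∈ Finset.range (n + 1), EA n k * V (n + 1) k = 1 := by
  obtain ⟨hC, hN⟩ := (memV_iff V).1 h
  induction n with
  | zero => simp [EA, hN]
  | succ n ih =>
    rw [← ih, ← EA_sum]
    refine Finset.sum_congr rfl fun k hk => ?_
    rw [hC.2.2 (n + 1) k (Finset.mem_range.1 hk)]
    push_cast; ring

theorem EA_term {V : ℕ → ℕ → ℝ} (h : memV V) {n k : ℕ} (hk : k ≤ n) :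
    EA n k * V (n + 1) k ≤ 1 := by
  rw [← EA_total h n]
  exact Finset.single_le_sum (f := fun k => EA n k * V (n + 1) k)
    (fun i _ => mul_nonneg (EA_nonneg _ _) (h.2.1 _ _)) (Finset.mem_range.2 (by omega))

theorem EA_bd1 {n k : ℕ} (hk : k ≤ n) : EA n k ≤ ((k : ℝ) + 1) ^ (n + 1) := by
  have := EA_term (Wb_mem k) hk
  rw [Wb_diag k (by omega), mul_one_div, div_le_one (by positivity)] at this
  exact this

theorem EA_bd2 {n k : ℕ} (hk : k ≤ n) : EA n (n - k) ≤ ((k : ℝ) + 1) ^ (n + 1) := by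
  have := EA_term (refl_mem (Wb_mem k)) (Nat.sub_le n k)
  unfold refl' at this
  have e : n + 1 - 1 - (n - k) = k := by omega
  rw [if_pos (by omega), e, Wb_diag k (by omega), mul_one_div, div_le_one (by positivity)] at this
  exact this

theorem avg_tendsto (w : ℕ → ℕ → ℝ) (w0 : ∀ N k, 0 ≤ w N k)
    (w1 : ∀ N, ∑ k ∈ Finset.range (N + 1), w N k ≤ 1)
    (wT : ∀ k : ℕ, Tendsto (fun N => w N k) atTop (𝓝 0)) :
    Tendsto (fun N => ∑ k ∈ Finset.range N, w N k / ((k : ℝ) + 1)) atTop (𝓝 0) := by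
  rw [Metric.tendsto_atTop]
  intro ε hε
  obtain ⟨M, hM⟩ := exists_nat_one_div_lt (half_pos hε)
  have T : Tendsto (fun N => ∑ k ∈ Finset.range M, w N k) atTop (𝓝 0) := by
    simpa using tendsto_finsetSum (Finset.range M) (fun k _ => wT k)
  obtain ⟨N0, hN0⟩ := (Metric.tendsto_atTop.1 T) (ε / 2) (half_pos hε)
  refine ⟨N0 + M, fun N hN => ?_⟩
  have a := hN0 N (by omega)
  rw [Real.dist_eq, sub_zero] at a ⊢
  have a' := (le_abs_self _).trans_lt a
  rw [abs_of_nonneg (Finset.sum_nonneg fun k _ => div_nonneg (w0 _ _) (by positivity))]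
  have hsplit := Finset.sum_range_add_sum_Ico (fun k => w N k / ((k : ℝ) + 1)) (by omega : M ≤ N)
  rw [← hsplit]
  have b1 : ∑ k ∈ Finset.range M, w N k / ((k : ℝ) + 1) ≤ ∑ k ∈ Finset.range M, w N k :=
    Finset.sum_le_sum fun k _ => div_le_self (w0 _ _) (by
      have : (0 : ℝ) ≤ k := Nat.cast_nonneg k
      linarith)
  have b2 : ∑ k ∈ Finset.Ico M N, w N k / ((k : ℝ) + 1)
      ≤ ∑ k ∈ Finset.Ico M N, w N k * (1 / ((M : ℝ) + 1)) :=
    Finset.sum_le_sum fun k hk => by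
      rw [mul_one_div]
      have : (M : ℝ) ≤ k := by exact_mod_cast (Finset.mem_Ico.1 hk).1
      exact div_le_div_of_nonneg_left (w0 _ _) (by positivity) (by linarith)
  have b3 : ∑ k ∈ Finset.Ico M N, w N k ≤ 1 := by
    refine le_trans (Finset.sum_le_sum_of_subset_of_nonneg ?_ fun k _ _ => w0 _ _) (w1 N)
    intro k hk
    have := Finset.mem_Ico.1 hk
    exact Finset.mem_range.2 (by omega)
  rw [← Finset.sum_mul] at b2
  have b4 : (∑ k ∈ Finset.Ico M N, w N k) * (1 / ((M : ℝ) + 1)) ≤ 1 * (1 / ((M : ℝ) + 1)) :=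
    mul_le_mul_of_nonneg_right b3 (by positivity)
  linarith

theorem key_inf {V : ℕ → ℕ → ℝ} (h : memV V)
    (hT1 : ∀ k : ℕ, Tendsto (fun n => ((k : ℝ) + 1) ^ n * V n k) atTop (𝓝 0))
    (hT2 : ∀ k : ℕ, Tendsto (fun n => ((k : ℝ) + 1) ^ n * refl' V n k) atTop (𝓝 0)) :
    V = Winf := by
  obtain ⟨⟨h1, h2, h4⟩, hN⟩ := (memV_iff V).1 h
  let U : ℕ → ℕ → ℝ := fun n k => V (n + 1) k - V (n + 1) (k + 1)
  have hU : ∀ n k, k < n → U n k = ((k : ℝ) + 1) * U (n + 1) k + ((n : ℝ) - k) * U (n + 1) (k + 1) := by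
    intro n k hk
    simp only [U]
    rw [h4 (n + 1) k (by omega), h4 (n + 1) (k + 1) (by omega)]
    push_cast; ring
  let T : ℕ → ℝ := fun n => ∑ k ∈ Finset.range (n + 1), EA n k * |U (n + 1) k|
  have Tmono : Monotone T := by
    refine monotone_nat_of_le_succ fun n => ?_
    simp only [T]
    rw [← EA_sum n (fun k => |U (n + 2) k|)]
    refine Finset.sum_le_sum fun k hk => mul_le_mul_of_nonneg_left ?_ (EA_nonneg _ _)
    have hk' := Finset.mem_range.1 hk
    have hkr : (k : ℝ) ≤ n := by exact_mod_cast (by omega : k ≤ n)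
    rw [hU (n + 1) k hk']
    refine (abs_add_le _ _).trans ?_
    rw [abs_mul, abs_mul, abs_of_nonneg (by positivity : (0 : ℝ) ≤ (k : ℝ) + 1),
      abs_of_nonneg (by push_cast; linarith : (0 : ℝ) ≤ ((n + 1 : ℕ) : ℝ) - k)]
    push_cast
    exact le_rfl
  let w1 : ℕ → ℕ → ℝ := fun N k => EA N k * V (N + 1) k
  let w2 : ℕ → ℕ → ℝ := fun N k => EA N (N - k) * refl' V (N + 1) k
  have hr := (refl_mem h).2.1
  have A1 := avg_tendsto w1 (fun N k => mul_nonneg (EA_nonneg _ _) (h2 _ _))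
    (fun N => (EA_total h N).le) (fun k => by
      refine squeeze_zero (fun N => mul_nonneg (EA_nonneg _ _) (h2 _ _)) (fun N => ?_)
        ((tendsto_add_atTop_iff_nat 1).2 (hT1 k))
      rcases Nat.lt_or_ge N k with hk | hk
      · simp [w1, EA_zero _ _ hk, h1 _ _ hk]
      · exact mul_le_mul_of_nonneg_right (EA_bd1 hk) (h2 _ _))
  have A2 := avg_tendsto w2 (fun N k => mul_nonneg (EA_nonneg _ _) (hr _ _))
    (fun N => by
      rw [← EA_total h N, ← Finset.sum_range_reflect (fun k => EA N k * V (N + 1) k)]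
      refine Finset.sum_le_sum fun k hk => ?_
      have hk' := Finset.mem_range.1 hk
      simp only [w2, refl']
      rw [if_pos hk']
      have : N + 1 - 1 - k = N - k := by omega
      rw [this]) (fun k => by
      refine squeeze_zero (fun N => mul_nonneg (EA_nonneg _ _) (hr _ _)) (fun N => ?_)
        ((tendsto_add_atTop_iff_nat 1).2 (hT2 k))
      rcases Nat.lt_or_ge N k with hk | hk
      · have : refl' V (N + 1) k = 0 := by unfold refl'; rw [if_neg (by omega)]
        simp [w2, this]
      · exact mul_le_mul_of_nonneg_right (EA_bd2 hk) (hr _ _))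
  have A := (A1.add A2)
  rw [add_zero] at A
  have A' := (tendsto_add_atTop_iff_nat 1).2 A
  have Tle : ∀ n, T n ≤ ∑ k ∈ Finset.range (n + 1), w1 (n + 1) k / ((k : ℝ) + 1) +
      ∑ k ∈ Finset.range (n + 1), w2 (n + 1) k / ((k : ℝ) + 1) := by
    intro n
    rw [← Finset.sum_range_reflect (fun k => w2 (n + 1) k / ((k : ℝ) + 1)),
      ← Finset.sum_add_distrib]
    refine Finset.sum_le_sum fun k hk => ?_
    have hk' : k ≤ n := by have := Finset.mem_range.1 hk; omega
    have hkr : (k : ℝ) ≤ n := by exact_mod_cast hk'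
    have v0 := h2 (n + 2) k
    have v1 := h2 (n + 2) (k + 1)
    have ab : |U (n + 1) k| ≤ V (n + 2) k + V (n + 2) (k + 1) := by
      simp only [U]
      rw [abs_le]; constructor <;> linarith
    have c1 : EA n k * V (n + 2) k ≤ w1 (n + 1) k / ((k : ℝ) + 1) := by
      rw [le_div_iff₀ (by positivity)]
      have := mul_le_mul_of_nonneg_right (EA_le1 n k hk') v0
      simp only [w1]
      linarith
    have c2 : EA n k * V (n + 2) (k + 1) ≤
        w2 (n + 1) (n + 1 - 1 - k) / (((n + 1 - 1 - k : ℕ) : ℝ) + 1) := by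
      rw [le_div_iff₀ (by positivity)]
      have := mul_le_mul_of_nonneg_right (EA_le2 n k) v1
      simp only [w2, refl']
      have e1 : n + 1 - (n + 1 - 1 - k) = k + 1 := by omega
      have e2 : n + 1 + 1 - 1 - (n + 1 - 1 - k) = k + 1 := by omega
      have e3 : n + 1 - 1 - k = n - k := by omega
      rw [if_pos (by omega), e1, e2, e3, Nat.cast_sub hk']
      linarith
    have := mul_le_mul_of_nonneg_left ab (EA_nonneg n k)
    linarith
  have T0 : ∀ n, T n ≤ 0 := by
    intro n
    refine ge_of_tendsto A' ?_
    filter_upwards [eventually_ge_atTop n] with m hm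
    exact (Tmono hm).trans (Tle m)
  have U0 : ∀ n k, k ≤ n → V (n + 2) k = V (n + 2) (k + 1) := by
    intro n k hk
    have a : EA n k * |U (n + 1) k| ≤ T n :=
      Finset.single_le_sum (f := fun k => EA n k * |U (n + 1) k|)
        (fun i _ => mul_nonneg (EA_nonneg _ _) (abs_nonneg _)) (Finset.mem_range.2 (by omega))
    have b := a.trans (T0 n)
    have c : |U (n + 1) k| ≤ 0 := by
      by_contra hc
      push Not at hc
      have := mul_pos (EA_pos n k hk) hc
      linarith
    have d := abs_nonpos_iff.1 c
    simp only [U] at d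
    linarith
  have C : ∀ n k, k ≤ n → V (n + 1) k = V (n + 1) 0 := by
    intro n k
    induction k with
    | zero => intro _; rfl
    | succ k ih =>
      intro hk
      obtain ⟨m, rfl⟩ : ∃ m, n = m + 1 := ⟨n - 1, by omega⟩
      rw [← ih (by omega)]
      exact (U0 m k (by omega)).symm
  have F : ∀ n, V (n + 1) 0 = 1 / (Nat.factorial (n + 1) : ℝ) := by
    intro n
    induction n with
    | zero => simp [hN]
    | succ n ih =>
      have e := h4 (n + 1) 0 (by omega)
      rw [ih, C (n + 1) (0 + 1) (by omega)] at e
      rw [Nat.factorial_succ (n + 1)]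
      push_cast at e ⊢
      have f0 : (Nat.factorial (n + 1) : ℝ) ≠ 0 := by positivity
      have f1 : (n : ℝ) + 1 + 1 ≠ 0 := by positivity
      field_simp at e ⊢
      linarith
  funext n k
  rcases Nat.lt_or_ge k n with hk | hk
  · obtain ⟨m, rfl⟩ : ∃ m, n = m + 1 := ⟨n - 1, by omega⟩
    rw [Winf_eq hk, C m k (by omega), F]
  · rw [h1 _ _ hk]; unfold Winf; rw [if_neg (by omega)]

theorem Winf_extreme : ExtremePt Winf := by
  refine extreme_of_min Winf_mem fun V c hV hc => ?_
  refine key_inf hV (fun k => tendsto_dom hV.2.1 hc (Winf_tendsto k))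
    (fun k => tendsto_dom (W := Winf) (c := c) (refl_mem hV).2.1 (fun n k => ?_) (Winf_tendsto k))
  rw [← Winf_refl]
  unfold refl'
  split_ifs
  · exact hc _ _
  · simp

theorem extreme_cases {W : ℕ → ℕ → ℝ} (h : ExtremePt W) (hne : ∀ κ, W ≠ Wbucket κ) (k : ℕ) :
    Tendsto (fun n => ((k : ℝ) + 1) ^ n * W n k) atTop (𝓝 0) := by
  have hC := ((memV_iff W).1 h.1).1
  obtain ⟨L, L0, LT, Lle⟩ := exists_lim hC k
  rcases L0.eq_or_lt with rfl | hL
  · exact LT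
  · exact absurd (extreme_peel h (Wb_mem k) hL (sub_cone hC k L0 Lle)) (hne k)

theorem stmt10 (W : ℕ → ℕ → ℝ) :
    ExtremePt W ↔
      (∃ κ : ℕ, W = Wbucket κ) ∨ (∃ κ : ℕ, W = Whatbucket κ) ∨ W = Winf := by
  constructor
  · intro h
    by_cases a : ∃ κ : ℕ, W = Wbucket κ
    · exact Or.inl a
    by_cases b : ∃ κ : ℕ, W = Whatbucket κ
    · exact Or.inr (Or.inl b)
    refine Or.inr (Or.inr (key_inf h.1 (extreme_cases h fun κ e => a ⟨κ, e⟩)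
      (extreme_cases (refl_extreme h) fun κ e => b ⟨κ, ?_⟩)))
    rw [What_eq, ← e, refl_refl ((memV_iff W).1 h.1).1]
  · rintro (⟨κ, rfl⟩ | ⟨κ, rfl⟩ | rfl)
    · exact Wb_extreme κ
    · rw [What_eq]; exact refl_extreme (Wb_extreme κ)
    · exact Winf_extreme
end
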